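/- Gluck's theorem (planar case). Let G = (V,E) be a finite simple graph with |V| ≥ 2. If there exists one realization p₀ : V → ℝ² such that the framework (G,p₀) is infinitesimally rigid, then for every generic realization p : V → ℝ² the framework (G,p) is infinitesimally rigid. -/

import Mathlib

open scoped Classical

set_option linter.unusedSectionVars false

noncomputable section

/-- Dot product on `ℝ × ℝ`. -/
def dot (x y : ℝ × ℝ) : ℝ := x.1 * y.1 + x.2 * y.2

variable {V : Type*} [Fintype V] [DecidableEq V]

/-- The rigidity functional `r_{ij}(v) = (p i − p j)·(v i − v j)` of an (unordered) edge,
viewed as a functional on the space of velocity assignments. -/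
def edgeFun (p : V → ℝ × ℝ) : Sym2 V → ((V → ℝ × ℝ) → ℝ) :=
  Sym2.lift ⟨fun i j => fun v => dot (p i - p j) (v i - v j), by
    intro i j
    funext v
    simp [dot]
    ring⟩

lemma edgeFun_add (p : V → ℝ × ℝ) (e : Sym2 V) (v w : V → ℝ × ℝ) :
    edgeFun p e (v + w) = edgeFun p e v + edgeFun p e w := by
  induction e using Sym2.ind with
  | _ i j =>
    simp [edgeFun, dot]
    ring

lemma edgeFun_smul (p : V → ℝ × ℝ) (e : Sym2 V) (c : ℝ) (v : V → ℝ × ℝ) :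
    edgeFun p e (c • v) = c * edgeFun p e v := by
  induction e using Sym2.ind with
  | _ i j =>
    simp [edgeFun, dot, smul_sub]
    ring

lemma edgeFun_zero (p : V → ℝ × ℝ) (e : Sym2 V) :
    edgeFun p e 0 = 0 := by
  induction e using Sym2.ind with
  | _ i j =>
    simp [edgeFun, dot]

/-- The space of infinitesimal flexes of the framework `(G, p)`. -/
def flexSpace (G : SimpleGraph V) (p : V → ℝ × ℝ) : Submodule ℝ (V → ℝ × ℝ) where
  carrier := {v | ∀ e ∈ G.edgeSet, edgeFun p e v = 0}
  add_mem' := by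
    intro v w hv hw e he
    rw [edgeFun_add, hv e he, hw e he, add_zero]
  zero_mem' := by
    intro e _
    exact edgeFun_zero p e
  smul_mem' := by
    intro c v hv e he
    rw [edgeFun_smul, hv e he, mul_zero]

/-- A framework is infinitesimally rigid if its space of infinitesimal flexes is
exactly 3-dimensional. -/
def InfinitesimallyRigid (G : SimpleGraph V) (p : V → ℝ × ℝ) : Prop :=
  Module.finrank ℝ (flexSpace G p) = 3

/-- A realization is generic if the `2|V|` coordinates of the points are
algebraically independent over `ℚ`. -/
def GenericRealization (p : V → ℝ × ℝ) : Prop :=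
  AlgebraicIndependent ℚ (Sum.elim (fun i => (p i).1) (fun i => (p i).2) : V ⊕ V → ℝ)

/-- The set of vertices incident to some edge of `E'`. -/
def spannedVerts (E' : Finset (Sym2 V)) : Finset V :=
  Finset.univ.filter (fun i => ∃ e ∈ E', i ∈ e)

/-- The rank of a matrix of ring elements can only increase when a specialization is replaced by
an injective one. -/
lemma rank_map_le_rank_map_of_injective {R m n K : Type*} [CommRing R] [Field K] [LinearOrder K]
    [IsStrictOrderedRing K] [Fintype m] [Fintype n] (M : Matrix m n R) (f g : R →+* K)
    (hg : Function.Injective g) : (M.map f).rank ≤ (M.map g).rank := by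
  obtain ⟨κ, a, ha, hspan, hli⟩ := exists_linearIndependent' K (M.map f).row
  have : Finite κ := Finite.of_injective a ha
  have : Fintype κ := Fintype.ofFinite κ
  set A := M.submatrix a id
  have hrank : (M.map f).rank = Fintype.card κ := by
    rw [Matrix.rank_eq_finrank_span_row, ← hspan, finrank_span_eq_card hli]
  have hA : (A.map f * (A.map f).transpose).rank = Fintype.card κ := by
    rw [Matrix.rank_self_mul_transpose]
    exact LinearIndependent.rank_matrix (M := A.map f) hli
  have gram (h : R →+* K) :
      (A.map h * (A.map h).transpose).det = h (A * A.transpose).det := by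
    rw [h.map_det, ← Matrix.transpose_map, RingHom.mapMatrix_apply, Matrix.map_mul]
  have hunit : IsUnit (A.map f * (A.map f).transpose) := by
    rw [← Matrix.linearIndependent_rows_iff_isUnit, linearIndependent_iff_card_eq_finrank_span]
    rw [Matrix.rank_eq_finrank_span_row] at hA
    exact hA.symm
  have hf : f (A * A.transpose).det ≠ 0 := by
    rw [← gram]
    exact ((Matrix.isUnit_iff_isUnit_det _).1 hunit).ne_zero
  have hne : (A.map g * (A.map g).transpose).det ≠ 0 := by
    rw [gram]
    exact (map_ne_zero_iff g hg).2 fun h => hf (by rw [h, map_zero])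
  rw [hrank, ← Matrix.rank_of_det_ne_zero hne, Matrix.rank_self_mul_transpose]
  exact Matrix.rank_submatrix_le (M.map g) a id

/-- The `x`- and `y`-coordinates of a family of points, as a single family. -/
def coordinates : (V → ℝ × ℝ) ≃ₗ[ℝ] (V ⊕ V → ℝ) where
  toFun p := Sum.elim (fun i => (p i).1) (fun i => (p i).2)
  invFun x i := (x (Sum.inl i), x (Sum.inr i))
  map_add' p q := by ext (i | i) <;> rfl
  map_smul' c p := by ext (i | i) <;> rfl
  left_inv p := rfl
  right_inv x := by ext (i | i) <;> rfl

@[simp]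
lemma coordinates_inl (p : V → ℝ × ℝ) (i : V) : coordinates p (Sum.inl i) = (p i).1 := rfl

@[simp]
lemma coordinates_inr (p : V → ℝ × ℝ) (i : V) : coordinates p (Sum.inr i) = (p i).2 := rfl

/-- The rigidity matrix with coordinates in a commutative ring; it has one row for each
orientation of each edge. -/
def rigidityMatrix {R : Type*} [CommRing R] (G : SimpleGraph V) (x : V ⊕ V → R) :
    Matrix G.Dart (V ⊕ V) R := fun d =>
  Sum.elim
    (fun k => (x (Sum.inl d.fst) - x (Sum.inl d.snd)) *
      ((Pi.single d.fst 1 : V → R) k - (Pi.single d.snd 1 : V → R) k))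
    (fun k => (x (Sum.inr d.fst) - x (Sum.inr d.snd)) *
      ((Pi.single d.fst 1 : V → R) k - (Pi.single d.snd 1 : V → R) k))

lemma rigidityMatrix_map {R S : Type*} [CommRing R] [CommRing S] (G : SimpleGraph V)
    (x : V ⊕ V → R) (f : R →+* S) :
    (rigidityMatrix G x).map f = rigidityMatrix G (f ∘ x) := by
  ext d (k | k) <;> simp [rigidityMatrix, Pi.single_apply, apply_ite f]

lemma rigidityMatrix_mulVec_coordinates (G : SimpleGraph V) (p v : V → ℝ × ℝ) (d : G.Dart) :
    (rigidityMatrix G (coordinates p)).mulVec (coordinates v) d = edgeFun p d.edge v := by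
  have hd : d.edge = s(d.fst, d.snd) := rfl
  simp [hd, Matrix.mulVec, dotProduct, rigidityMatrix, edgeFun, dot, mul_assoc,
    ← Finset.mul_sum, sub_mul, Finset.sum_sub_distrib, Pi.single_apply]

lemma flexSpace_eq_comap_ker (G : SimpleGraph V) (p : V → ℝ × ℝ) :
    flexSpace G p = (LinearMap.ker (rigidityMatrix G (coordinates p)).mulVecLin).comap
      (coordinates : (V → ℝ × ℝ) ≃ₗ[ℝ] (V ⊕ V → ℝ)).toLinearMap := by
  ext v
  rw [Submodule.mem_comap, LinearMap.mem_ker]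
  constructor
  · intro hv
    ext d
    exact (rigidityMatrix_mulVec_coordinates G p v d).trans (hv _ d.edge_mem)
  · intro hv e he
    induction e using Sym2.ind with
    | _ i j =>
      exact (rigidityMatrix_mulVec_coordinates G p v ⟨(i, j), he⟩).symm.trans (congrFun hv _)

lemma rank_rigidityMatrix_add_finrank_flexSpace (G : SimpleGraph V) (p : V → ℝ × ℝ) :
    (rigidityMatrix G (coordinates p)).rank + Module.finrank ℝ (flexSpace G p) =
      Fintype.card (V ⊕ V) := by
  have h := LinearMap.finrank_range_add_finrank_ker (rigidityMatrix G (coordinates p)).mulVecLin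
  rw [Module.finrank_fintype_fun_eq_card] at h
  rw [← h, flexSpace_eq_comap_ker, Submodule.comap_equiv_eq_map_symm,
    LinearEquiv.finrank_map_eq]
  rfl

/-- Translations and the infinitesimal rotation are independent flexes unless all points have
the same first coordinate. -/
lemma three_le_finrank_flexSpace (G : SimpleGraph V) (p : V → ℝ × ℝ) {i j : V}
    (hij : (p i).1 ≠ (p j).1) : 3 ≤ Module.finrank ℝ (flexSpace G p) := by
  let b : Fin 3 → flexSpace G p :=
    ![⟨fun _ => (1, 0), fun e _ => by
        induction e using Sym2.ind with | _ i j => simp [edgeFun, dot]⟩,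
      ⟨fun _ => (0, 1), fun e _ => by
        induction e using Sym2.ind with | _ i j => simp [edgeFun, dot]⟩,
      ⟨fun k => (-(p k).2, (p k).1), fun e _ => by
        induction e using Sym2.ind with | _ i j => simp [edgeFun, dot]; ring⟩]
  have hb : LinearIndependent ℝ b := by
    rw [Fintype.linearIndependent_iff]
    intro c hc
    have h (k : V) : c 0 - c 2 * (p k).2 = 0 ∧ c 1 + c 2 * (p k).1 = 0 := by
      have := congrFun (congrArg Subtype.val hc) k
      simpa [b, Fin.sum_univ_three, Prod.ext_iff, sub_eq_add_neg] using this
    have h2 : c 2 = 0 := by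
      have : c 2 * ((p i).1 - (p j).1) = 0 := by linear_combination (h i).2 - (h j).2
      exact (mul_eq_zero.1 this).resolve_right (sub_ne_zero.2 hij)
    have h0 : c 0 = 0 := by simpa [h2] using (h i).1
    have h1 : c 1 = 0 := by simpa [h2] using (h i).2
    intro k
    fin_cases k <;> assumption
  simpa using hb.fintype_card_le_finrank

/-- **Gluck's theorem (planar case).** If a finite simple graph on at least two
vertices has one infinitesimally rigid realization in the plane, then every
generic realization of it is infinitesimally rigid. -/
theorem gluck_theorem (G : SimpleGraph V) (h2 : 2 ≤ Fintype.card V)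
    (p₀ : V → ℝ × ℝ) (h₀ : InfinitesimallyRigid G p₀)
    (p : V → ℝ × ℝ) (hp : GenericRealization p) :
    InfinitesimallyRigid G p := by
  have : Nontrivial V := Fintype.one_lt_card_iff_nontrivial.1 h2
  obtain ⟨i, j, hij⟩ := exists_pair_ne V
  have hinj : Function.Injective (MvPolynomial.aeval (R := ℚ) (coordinates p)) := hp
  have hlower : 3 ≤ Module.finrank ℝ (flexSpace G p) :=
    three_le_finrank_flexSpace G p fun h => hij (Sum.inl_injective (hp.injective h))
  have hrank := rank_map_le_rank_map_of_injective (rigidityMatrix G MvPolynomial.X)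
    (MvPolynomial.aeval (R := ℚ) (coordinates p₀)).toRingHom
    (MvPolynomial.aeval (R := ℚ) (coordinates p)).toRingHom hinj
  have hX (q : V → ℝ × ℝ) :
      (MvPolynomial.aeval (R := ℚ) (coordinates q)).toRingHom ∘ MvPolynomial.X =
        coordinates q := by
    ext k
    simp
  rw [rigidityMatrix_map, rigidityMatrix_map, hX, hX] at hrank
  have e₀ := rank_rigidityMatrix_add_finrank_flexSpace G p₀
  have e := rank_rigidityMatrix_add_finrank_flexSpace G p
  unfold InfinitesimallyRigid at h₀ ⊢
  omega

end
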